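/- The binary code of length 24 generated by the rows {111111111100000000000000, 000000000011111111111100, 110000000011111100000011, 001111000011000011000011, 000000110010110010110011, 101100101000001101111100, 001010000100101011101010} is a [24,7,10] code, and its automorphism group has order 240. -/

import Mathlib

def theRows : Set (Fin 24 → ZMod 2) :=
  {(![1,1,1,1,1,1,1,1,1,1,0,0,0,0,0,0,0,0,0,0,0,0,0,0] : Fin 24 → ZMod 2),
    (![0,0,0,0,0,0,0,0,0,0,1,1,1,1,1,1,1,1,1,1,1,1,0,0] : Fin 24 → ZMod 2),
    (![1,1,0,0,0,0,0,0,0,0,1,1,1,1,1,1,0,0,0,0,0,0,1,1] : Fin 24 → ZMod 2),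
    (![0,0,1,1,1,1,0,0,0,0,1,1,0,0,0,0,1,1,0,0,0,0,1,1] : Fin 24 → ZMod 2),
    (![0,0,0,0,0,0,1,1,0,0,1,0,1,1,0,0,1,0,1,1,0,0,1,1] : Fin 24 → ZMod 2),
    (![1,0,1,1,0,0,1,0,1,0,0,0,0,0,1,1,0,1,1,1,1,1,0,0] : Fin 24 → ZMod 2),
    (![0,0,1,0,1,0,0,0,0,1,0,0,1,0,1,0,1,1,1,0,1,0,1,0] : Fin 24 → ZMod 2)}
/-- The code generated by the given rows. -/
noncomputable def theCode : Submodule (ZMod 2) (Fin 24 → ZMod 2) :=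
  Submodule.span (ZMod 2) theRows

/-- The columns, read in binary, of a systematic generator matrix of the code. -/
def columns : List ℕ :=
  [2, 16, 106, 101, 120, 119, 8, 26, 32, 61, 44, 4, 102, 105, 92, 83, 1, 59, 86, 89, 126, 113, 64, 79]

/-- The set of columns, encoded by its characteristic bits. -/
def columnMask : ℕ := 87074947623648659929890713388735070486

/-- `1` if `x` is a column and `0` otherwise. -/
def columnBit (x : ℕ) : ℕ := (columnMask >>> x) % 2

/-- The number of ways to write `x` as a column or as an ordered sum of two columns. -/
def columnWeight (x : ℕ) : ℕ :=
  (columns.map fun c => columnBit (x ^^^ c)).sum + columnBit x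

/-- The values of `columnWeight` below `128`, as the digits of a number in base `256`. -/
def weightTable : ℕ :=
  5620555873829845322744912087403484801483034541301100667598869504579111784779068482799833957131185396942616188375964887452081786221768214193569821491478792705298644272267966271954734544778871505167952649388545319406146115192898869513470545677381016047199607341157578437754815849449018825039428108164964352280

/-- The entry of `weightTable` at `x`. -/
def tableWeight (x : ℕ) : ℕ := (weightTable >>> (8 * x)) % 256

/-- Whether the linear map given by the images `t` of the basis vectors `2 ^ k` with
`k < t.length`, the last one first, shifted to send `x` to `y`, preserves weights. -/
def weightCheck : List ℕ → ℕ → ℕ → Bool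
  | [], x, y => Nat.beq (tableWeight x) (tableWeight y)
  | c :: t, x, y => weightCheck t x y && weightCheck t (x ^^^ 2 ^ t.length) (y ^^^ c)

/-- The extensions of `t` by `n` columns that pass `weightCheck` at each step. -/
def extensions : ℕ → List ℕ → List (List ℕ)
  | 0, t => [t]
  | n + 1, t => columns.flatMap fun c =>
      bif weightCheck t (2 ^ t.length) c then extensions n (c :: t) else []

/-- The linear map, on numbers read as binary vectors, that sends `2 ^ k` for `k < t.length` to the
`k`-th entry of `t`, counted from the end. -/
def combine : List ℕ → ℕ → ℕ
  | [], _ => 0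
  | c :: t, x => (if x.testBit t.length then c else 0) ^^^ combine t x

theorem combine_xor (t : List ℕ) (x y : ℕ) :
    combine t (x ^^^ y) = combine t x ^^^ combine t y := by
  induction t with
  | nil => simp [combine]
  | cons c t ih =>
    simp only [combine, ih, Nat.testBit_xor]
    cases x.testBit t.length <;> cases y.testBit t.length <;>
      simp [Nat.xor_assoc, Nat.xor_left_comm]

theorem combine_zero (t : List ℕ) : combine t 0 = 0 := by
  induction t with
  | nil => rfl
  | cons c t ih => simp [combine, ih]

theorem combine_two_pow_of_length_le (t : List ℕ) {n : ℕ} (hn : t.length ≤ n) :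
    combine t (2 ^ n) = 0 := by
  induction t with
  | nil => rfl
  | cons c t ih =>
    rw [List.length_cons] at hn
    simp [combine, ih (by omega), show n ≠ t.length by omega]

theorem combine_append_cons (r s : List ℕ) (c : ℕ) :
    combine (r ++ c :: s) (2 ^ s.length) = c := by
  induction r with
  | nil => simp [combine, combine_two_pow_of_length_le]
  | cons d r ih =>
    simp [combine, ih, show s.length ≠ r.length + (s.length + 1) by omega]

theorem combine_combine (t u : List ℕ) (x : ℕ) :
    combine u (combine t x) = combine (t.map (combine u)) x := by
  induction t with
  | nil => exact combine_zero u
  | cons c t ih =>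
    simp only [combine, combine_xor, ih, List.map_cons, List.length_map]
    split <;> simp [combine_zero]

theorem combine_lt {t : List ℕ} {n : ℕ} (ht : ∀ c ∈ t, c < 2 ^ n) (x : ℕ) :
    combine t x < 2 ^ n := by
  induction t with
  | nil => exact Nat.two_pow_pos n
  | cons c t ih =>
    refine Nat.xor_lt_two_pow ?_ (ih fun d hd => ht d (List.mem_cons_of_mem c hd))
    split
    · exact ht c List.mem_cons_self
    · exact Nat.two_pow_pos n

theorem xor_xor_self_left (m n : ℕ) : n ^^^ (m ^^^ n) = m := by
  rw [Nat.xor_comm m, ← Nat.xor_assoc, Nat.xor_self, Nat.zero_xor]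

theorem xor_two_pow_lt {m k : ℕ} (hm : m < 2 ^ (k + 1)) (hk : m.testBit k) :
    m ^^^ 2 ^ k < 2 ^ k := by
  refine Nat.lt_pow_two_of_testBit _ fun i hi => ?_
  rw [Nat.testBit_xor, Nat.testBit_two_pow]
  rcases hi.eq_or_lt with rfl | hi
  · simp [hk]
  · simp [Nat.testBit_lt_two_pow (hm.trans_le (Nat.pow_le_pow_right two_pos hi)), hi.ne]

theorem lt_two_pow_of_testBit_eq_false {m k : ℕ} (hm : m < 2 ^ (k + 1))
    (hk : m.testBit k = false) : m < 2 ^ k := by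
  refine Nat.lt_pow_two_of_testBit _ fun i hi => ?_
  rcases hi.eq_or_lt with rfl | hi
  · exact hk
  · exact Nat.testBit_lt_two_pow (hm.trans_le (Nat.pow_le_pow_right two_pos hi))

theorem weightCheck_spec {t : List ℕ} {x y : ℕ} (h : weightCheck t x y) {m : ℕ}
    (hm : m < 2 ^ t.length) : tableWeight (x ^^^ m) = tableWeight (y ^^^ combine t m) := by
  induction t generalizing x y m with
  | nil =>
    obtain rfl : m = 0 := by simpa using hm
    simpa [weightCheck, combine] using h
  | cons c t ih =>
    simp only [weightCheck, Bool.and_eq_true] at h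
    cases hb : m.testBit t.length with
    | true =>
      have h2 := ih h.2 (xor_two_pow_lt hm hb)
      rw [combine_xor, combine_two_pow_of_length_le t le_rfl, Nat.xor_zero, Nat.xor_assoc,
        xor_xor_self_left, Nat.xor_assoc] at h2
      simpa [combine, hb] using h2
    | false =>
      simpa [combine, hb] using ih h.1 (lt_two_pow_of_testBit_eq_false hm hb)

theorem weightCheck_combine {T : List ℕ}
    (hT : ∀ x < 2 ^ T.length, tableWeight (combine T x) = tableWeight x) {t : List ℕ}
    (ht : t <:+ T) {x : ℕ} (hx : x < 2 ^ T.length) : weightCheck t x (combine T x) := by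
  induction t generalizing x with
  | nil => simp [weightCheck, hT x hx]
  | cons c t ih =>
    have ht' : t <:+ T := (List.suffix_cons c t).trans ht
    have hlen : t.length < T.length := ht.length_le
    have hlt : x ^^^ 2 ^ t.length < 2 ^ T.length :=
      Nat.xor_lt_two_pow hx (Nat.pow_lt_pow_right one_lt_two hlen)
    have h2 := ih ht' hlt
    obtain ⟨r, rfl⟩ := ht
    rw [combine_xor, combine_append_cons] at h2
    simp only [weightCheck, Bool.and_eq_true]
    exact ⟨ih ht' hx, h2⟩

theorem mem_extensions_iff {n : ℕ} {t T : List ℕ} : T ∈ extensions (n + 1) t ↔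
    ∃ c ∈ columns, weightCheck t (2 ^ t.length) c ∧ T ∈ extensions n (c :: t) := by
  simp only [extensions, List.mem_flatMap]
  refine exists_congr fun c => and_congr_right fun _ => ?_
  cases weightCheck t (2 ^ t.length) c <;> simp

theorem suffix_of_mem_extensions {n : ℕ} {t T : List ℕ} (h : T ∈ extensions n t) : t <:+ T := by
  induction n generalizing t with
  | zero => simp_all [extensions]
  | succ n ih =>
    obtain ⟨c, -, -, h⟩ := mem_extensions_iff.1 h
    exact (List.suffix_cons c t).trans (ih h)

theorem length_of_mem_extensions {n : ℕ} {t T : List ℕ} (h : T ∈ extensions n t) :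
    T.length = t.length + n := by
  induction n generalizing t with
  | zero => simp_all [extensions]
  | succ n ih =>
    obtain ⟨c, -, -, h⟩ := mem_extensions_iff.1 h
    rw [ih h, List.length_cons]
    omega

theorem subset_columns_of_mem_extensions {n : ℕ} {t T : List ℕ} (ht : t ⊆ columns)
    (h : T ∈ extensions n t) : T ⊆ columns := by
  induction n generalizing t with
  | zero => simp_all [extensions]
  | succ n ih =>
    obtain ⟨c, hc, -, h⟩ := mem_extensions_iff.1 h
    exact ih (List.cons_subset.2 ⟨hc, ht⟩) h

theorem tableWeight_combine_of_mem_extensions {n : ℕ} {t T : List ℕ}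
    (ht : ∀ x < 2 ^ t.length, tableWeight (combine t x) = tableWeight x)
    (h : T ∈ extensions n t) {x : ℕ} (hx : x < 2 ^ T.length) :
    tableWeight (combine T x) = tableWeight x := by
  induction n generalizing t with
  | zero =>
    obtain rfl : T = t := by simpa [extensions] using h
    exact ht x hx
  | succ n ih =>
    obtain ⟨c, -, hw, h⟩ := mem_extensions_iff.1 h
    refine ih (fun m hm => ?_) h
    cases hb : m.testBit t.length with
    | true =>
      have h2 := weightCheck_spec hw (xor_two_pow_lt hm hb)
      rw [combine_xor, combine_two_pow_of_length_le t le_rfl, Nat.xor_zero,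
        xor_xor_self_left] at h2
      simpa [combine, hb] using h2.symm
    | false => simpa [combine, hb] using ht m (lt_two_pow_of_testBit_eq_false hm hb)

theorem mem_extensions {T : List ℕ} (hc : T ⊆ columns)
    (hT : ∀ x < 2 ^ T.length, tableWeight (combine T x) = tableWeight x) {n : ℕ} {t : List ℕ}
    (ht : t <:+ T) (hn : T.length = t.length + n) : T ∈ extensions n t := by
  induction n generalizing t with
  | zero => simp [extensions, ht.eq_of_length hn.symm]
  | succ n ih =>
    obtain ⟨r, rfl⟩ := ht
    obtain ⟨r, c, rfl⟩ : ∃ r' c, r = r' ++ [c] := by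
      rcases List.eq_nil_or_concat r with rfl | h
      · simp at hn
      · simpa using h
    rw [List.append_assoc, List.singleton_append] at *
    refine mem_extensions_iff.2 ⟨c, hc (by simp), ?_, ih ⟨r, rfl⟩ (by simp at hn ⊢; omega)⟩
    have h := weightCheck_combine hT (t := t) ⟨r ++ [c], by simp⟩ (x := 2 ^ t.length)
      (Nat.pow_lt_pow_right one_lt_two (by simp; omega))
    rwa [combine_append_cons] at h

theorem nodup_extensions (n : ℕ) (t : List ℕ) : (extensions n t).Nodup := by
  induction n generalizing t with
  | zero => simp [extensions]
  | succ n ih =>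
    refine List.nodup_flatMap.2 ⟨fun c _ => ?_, ?_⟩
    · cases weightCheck t (2 ^ t.length) c
      · simp
      · exact ih (c :: t)
    · refine List.Pairwise.imp ?_ (show columns.Nodup by decide)
      intro c d hcd T hTc hTd
      have key : ∀ e, T ∈ (bif weightCheck t (2 ^ t.length) e then extensions n (e :: t) else []) →
          e :: t <:+ T := by
        intro e he
        cases h : weightCheck t (2 ^ t.length) e
        · simp [h] at he
        · exact suffix_of_mem_extensions (by simpa [h] using he)
      have h := List.suffix_of_suffix_length_le (key c hTc) (key d hTd) (by simp)
      exact hcd (List.cons.inj (h.eq_of_length (by simp))).1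

theorem length_extensions : (extensions 7 []).length = 240 := by
  decide +kernel

theorem tableWeight_eq : ∀ x < 2 ^ 7, tableWeight x = columnWeight x := by
  decide +kernel

/-- The `i`-th column. -/
def column (i : Fin 24) : ℕ := columns.get i

theorem column_injective : Function.Injective column := by
  decide +kernel

theorem column_mem (i : Fin 24) : column i ∈ columns := List.get_mem _ _

theorem exists_column_eq {c : ℕ} (hc : c ∈ columns) : ∃ i, column i = c := List.get_of_mem hc

theorem column_lt (i : Fin 24) : column i < 2 ^ 7 := by
  revert i
  decide

theorem columnBit_eq : ∀ x < 2 ^ 7, columnBit x = if x ∈ columns then 1 else 0 := by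
  decide +kernel

theorem columnWeight_eq (x : ℕ) :
    columnWeight x = ∑ i, columnBit (x ^^^ column i) + columnBit x := by
  have h : columns = List.ofFn column := by decide
  rw [columnWeight, h, List.map_ofFn, List.sum_ofFn]
  rfl

theorem mem_columns_of_weight : ∀ x < 2 ^ 7, tableWeight x = 1 ↔ x ∈ columns := by
  decide +kernel

theorem eq_zero_of_weight : ∀ x < 2 ^ 7, tableWeight x = tableWeight 0 → x = 0 := by
  decide +kernel

/-- The positions of an information set: the columns there are the powers of two. -/
def infoSet : Fin 7 → Fin 24 := ![16, 0, 11, 6, 1, 8, 22]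

theorem column_infoSet (k : Fin 7) : column (infoSet k) = 2 ^ (k : ℕ) := by
  revert k
  decide

/-- The columns to which `σ` moves the information set, the last one first. -/
def images (σ : Fin 24 → Fin 24) : List ℕ :=
  [column (σ 22), column (σ 8), column (σ 1), column (σ 6), column (σ 11), column (σ 0),
    column (σ 16)]

theorem images_subset (σ : Fin 24 → Fin 24) : images σ ⊆ columns := by
  simp [images, column_mem]

theorem combine_images_lt (σ : Fin 24 → Fin 24) (x : ℕ) : combine (images σ) x < 2 ^ 7 :=
  combine_lt (fun c hc => by
    obtain ⟨i, rfl⟩ := exists_column_eq (images_subset σ hc)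
    exact column_lt i) x

/-- `σ` extends to a linear map of the space of columns. -/
def IsLinear (σ : Fin 24 → Fin 24) : Prop :=
  ∀ i, column (σ i) = combine (images σ) (column i)

theorem combine_images_images {σ τ : Fin 24 → Fin 24} (hτ : IsLinear τ) (h : ∀ i, τ (σ i) = i)
    {x : ℕ} (hx : x < 2 ^ 7) : combine (images τ) (combine (images σ) x) = x := by
  have h1 : (images σ).map (combine (images τ)) = images id := by
    have h2 (i) : combine (images τ) (column (σ i)) = column i := by rw [← hτ, h]
    generalize combine (images τ) = g at h2
    simp only [images, List.map_cons, List.map_nil, h2, id]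
  rw [combine_combine, h1]
  revert x
  decide +kernel

theorem columnBit_le {σ : Fin 24 → Fin 24} (hσ : IsLinear σ) {x : ℕ} (hx : x < 2 ^ 7) :
    columnBit x ≤ columnBit (combine (images σ) x) := by
  rw [columnBit_eq x hx, columnBit_eq _ (combine_images_lt σ x)]
  by_cases h : x ∈ columns
  · obtain ⟨i, rfl⟩ := exists_column_eq h
    simp [← hσ i, column_mem]
  · simp [h]

theorem columnWeight_le {σ : Equiv.Perm (Fin 24)} (hσ : IsLinear σ) {x : ℕ} (hx : x < 2 ^ 7) :
    columnWeight x ≤ columnWeight (combine (images σ) x) := by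
  rw [columnWeight_eq, columnWeight_eq,
    ← Equiv.sum_comp σ fun i => columnBit (combine (images σ) x ^^^ column i)]
  refine add_le_add (Finset.sum_le_sum fun i _ => ?_) (columnBit_le hσ hx)
  rw [hσ i, ← combine_xor]
  exact columnBit_le hσ (Nat.xor_lt_two_pow hx (column_lt i))

theorem tableWeight_combine_images {σ : Equiv.Perm (Fin 24)} (hσ : IsLinear σ)
    (hσ' : IsLinear σ.symm) {x : ℕ} (hx : x < 2 ^ 7) :
    tableWeight (combine (images σ) x) = tableWeight x := by
  have hlt := combine_images_lt σ x
  rw [tableWeight_eq _ hlt, tableWeight_eq x hx]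
  refine le_antisymm ?_ (columnWeight_le hσ hx)
  simpa [combine_images_images hσ' σ.symm_apply_apply hx] using columnWeight_le hσ' hlt

theorem exists_perm_of_mem_extensions {T : List ℕ} (hT : T ∈ extensions 7 []) :
    ∃ σ : Equiv.Perm (Fin 24), IsLinear σ ∧ images σ = T := by
  have hc : T ⊆ columns := subset_columns_of_mem_extensions (List.nil_subset _) hT
  have hlen : T.length = 7 := length_of_mem_extensions hT
  have hw : ∀ x < 2 ^ 7, tableWeight (combine T x) = tableWeight x := fun x hx =>
    tableWeight_combine_of_mem_extensions (by simp [combine]) hT (by rwa [hlen])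
  have hlt : ∀ x, combine T x < 2 ^ 7 := combine_lt fun c h => by
    obtain ⟨i, rfl⟩ := exists_column_eq (hc h)
    exact column_lt i
  have hex : ∀ i, ∃ j, column j = combine T (column i) := fun i =>
    exists_column_eq <| (mem_columns_of_weight _ (hlt _)).1 <| by
      rw [hw _ (column_lt i), mem_columns_of_weight _ (column_lt i)]
      exact column_mem i
  choose f hf using hex
  have hinj : Function.Injective f := by
    intro i j hij
    have h0 : combine T (column i ^^^ column j) = 0 := by
      rw [combine_xor, ← hf, ← hf, hij, Nat.xor_self]
    have hx := Nat.xor_lt_two_pow (column_lt i) (column_lt j)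
    refine column_injective (Nat.xor_eq_zero_iff.1 (eq_zero_of_weight _ hx ?_))
    rw [← hw _ hx, h0]
  have himg : images f = T := by
    obtain ⟨c₆, c₅, c₄, c₃, c₂, c₁, c₀, rfl⟩ :
        ∃ c₆ c₅ c₄ c₃ c₂ c₁ c₀, T = [c₆, c₅, c₄, c₃, c₂, c₁, c₀] := by
      match T, hlen with
      | [c₆, c₅, c₄, c₃, c₂, c₁, c₀], _ => exact ⟨c₆, c₅, c₄, c₃, c₂, c₁, c₀, rfl⟩
    simp only [images, hf]
    simp [combine, column, columns, Nat.testBit_eq_decide_div_mod_eq]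
  refine ⟨Equiv.ofBijective f (Finite.injective_iff_bijective.1 hinj), fun i => ?_, himg⟩
  simp only [Equiv.coe_ofBijective, himg, hf]

/-- The `k`-th binary digit of `x`. -/
def bit (k x : ℕ) : ZMod 2 := if x.testBit k then 1 else 0

theorem bit_xor (k x y : ℕ) : bit k (x ^^^ y) = bit k x + bit k y := by
  simp only [bit, Nat.testBit_xor]
  cases x.testBit k <;> cases y.testBit k <;> decide

theorem eq_of_bit_eq {x y : ℕ} (hx : x < 2 ^ 7) (hy : y < 2 ^ 7)
    (h : ∀ k : Fin 7, bit k x = bit k y) : x = y := by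
  refine Nat.eq_of_testBit_eq fun k => ?_
  rcases lt_or_ge k 7 with hk | hk
  · have := h ⟨k, hk⟩
    simp only [bit] at this
    cases hx : x.testBit k <;> cases hy : y.testBit k <;> simp_all
  · have hp : 2 ^ 7 ≤ 2 ^ k := Nat.pow_le_pow_right two_pos hk
    rw [Nat.testBit_lt_two_pow (hx.trans_le hp), Nat.testBit_lt_two_pow (hy.trans_le hp)]

theorem bit_combine_images (σ : Fin 24 → Fin 24) (k x : ℕ) :
    bit k (combine (images σ) x) =
      ∑ j : Fin 7, bit k (column (σ (infoSet j))) * bit j x := by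
  have h (j c : ℕ) : bit k (if x.testBit j then c else 0) = bit k c * bit j x := by
    cases hb : x.testBit j <;> simp [bit, hb]
  have h0 : bit k 0 = 0 := by simp [bit]
  simp only [images, combine, bit_xor, h, h0, Fin.sum_univ_seven]
  simp [infoSet]
  ring

/-- The word of the code with digits `u` on the information set. -/
def encode (u : Fin 7 → ZMod 2) (i : Fin 24) : ZMod 2 := ∑ k : Fin 7, u k * bit k (column i)

theorem encode_infoSet (u : Fin 7 → ZMod 2) (k : Fin 7) : encode u (infoSet k) = u k := by
  simp [encode, column_infoSet, bit, Nat.testBit_two_pow, Fin.val_inj]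

theorem encode_eq_of_mem {v : Fin 24 → ZMod 2} (hv : v ∈ theCode) :
    encode (v ∘ infoSet) = v := by
  induction hv using Submodule.span_induction with
  | mem v hv =>
    simp only [theRows, Set.mem_insert_iff, Set.mem_singleton_iff] at hv
    rcases hv with rfl | rfl | rfl | rfl | rfl | rfl | rfl <;> decide +kernel
  | zero => funext i; simp [encode]
  | add v w _ _ hv hw =>
    nth_rw 2 [← hv, ← hw]
    funext i
    simp [encode, add_mul, Finset.sum_add_distrib]
  | smul a v _ hv =>
    nth_rw 2 [← hv]
    funext i
    simp [encode, Finset.mul_sum, mul_assoc]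

/-- The digits of the given generators on the information set. -/
def infoDigits : Matrix (Fin 7) (Fin 7) (ZMod 2) :=
  !![0, 1, 0, 1, 1, 1, 0;
     1, 0, 1, 0, 0, 0, 0;
     0, 1, 1, 0, 1, 0, 1;
     1, 0, 1, 0, 0, 0, 1;
     1, 0, 0, 1, 0, 0, 1;
     0, 1, 0, 1, 0, 1, 0;
     1, 0, 0, 0, 0, 0, 1]

/-- The inverse of `infoDigits`. -/
def infoDigitsInv : Matrix (Fin 7) (Fin 7) (ZMod 2) :=
  !![0, 1, 0, 1, 0, 0, 1;
     1, 1, 1, 0, 0, 1, 1;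
     0, 0, 0, 1, 0, 0, 1;
     0, 0, 0, 0, 1, 0, 1;
     1, 0, 0, 0, 0, 1, 0;
     1, 1, 1, 0, 1, 0, 0;
     0, 1, 0, 1, 0, 0, 0]

theorem encode_infoDigits_mem (j : Fin 7) : encode (infoDigits j) ∈ theRows := by
  simp only [theRows, Set.mem_insert_iff, Set.mem_singleton_iff]
  revert j
  decide +kernel

theorem bit_column_mem (k : Fin 7) : (fun i => bit k (column i)) ∈ theCode := by
  have h : (fun i => bit k (column i)) = ∑ j, infoDigitsInv k j • encode (infoDigits j) := by
    revert k
    decide +kernel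
  rw [h]
  exact Submodule.sum_mem _ fun j _ =>
    Submodule.smul_mem _ _ (Submodule.subset_span (encode_infoDigits_mem j))

theorem encode_mem (u : Fin 7 → ZMod 2) : encode u ∈ theCode := by
  have h : encode u = ∑ k : Fin 7, u k • fun i => bit k (column i) := by
    funext i
    simp [encode]
  rw [h]
  exact Submodule.sum_mem _ fun k _ => Submodule.smul_mem _ _ (bit_column_mem k)

theorem finrank_theCode : Module.finrank (ZMod 2) theCode = 7 := by
  let f := (LinearMap.funLeft (ZMod 2) (ZMod 2) infoSet).domRestrict theCode
  have hf : Function.Bijective f := by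
    refine ⟨fun v w h => Subtype.ext ?_, fun u => ⟨⟨encode u, encode_mem u⟩, ?_⟩⟩
    · rw [← encode_eq_of_mem v.2, ← encode_eq_of_mem w.2]
      exact congrArg encode h
    · exact funext (encode_infoSet u)
  rw [(LinearEquiv.ofBijective f hf).finrank_eq, Module.finrank_fin_fun]

theorem ten_le_hammingNorm_encode :
    ∀ u : Fin 7 → ZMod 2, u ≠ 0 → 10 ≤ hammingNorm (encode u) := by
  decide +kernel

theorem ten_le_hammingNorm {v : Fin 24 → ZMod 2} (hv : v ∈ theCode) (h0 : v ≠ 0) :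
    10 ≤ hammingNorm v := by
  rw [← encode_eq_of_mem hv]
  refine ten_le_hammingNorm_encode _ fun h => h0 ?_
  rw [← encode_eq_of_mem hv, h]
  funext i
  simp [encode]

theorem isLinear_iff (σ : Fin 24 → Fin 24) :
    IsLinear σ ↔ ∀ v ∈ theCode, v ∘ σ ∈ theCode := by
  constructor
  · intro hσ v hv
    have h : encode (v ∘ σ ∘ infoSet) = v ∘ σ := by
      funext i
      have hv' := congrFun (encode_eq_of_mem hv)
      simp only [Function.comp_apply, ← hv' (σ _), encode]
      simp only [hσ i, bit_combine_images, Finset.mul_sum, Finset.sum_mul]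
      rw [Finset.sum_comm]
      simp only [mul_assoc]
    rw [← h]
    exact encode_mem _
  · intro h i
    refine eq_of_bit_eq (column_lt _) (combine_images_lt σ _) fun k => ?_
    rw [bit_combine_images]
    exact (congrFun (encode_eq_of_mem (h _ (bit_column_mem k))) i).symm

/-- The automorphism condition on a coordinate permutation. -/
def IsAut (σ : Equiv.Perm (Fin 24)) : Prop :=
  Submodule.map (LinearMap.funLeft (ZMod 2) (ZMod 2) σ) theCode = theCode

theorem IsAut.symm {σ : Equiv.Perm (Fin 24)} (hσ : IsAut σ) : IsAut σ.symm := by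
  unfold IsAut at *
  nth_rw 1 [← hσ]
  rw [← Submodule.map_comp, ← LinearMap.funLeft_comp, σ.self_comp_symm,
    show LinearMap.funLeft (ZMod 2) (ZMod 2) (id : Fin 24 → Fin 24) = LinearMap.id from rfl,
    Submodule.map_id]

theorem isAut_iff (σ : Equiv.Perm (Fin 24)) : IsAut σ ↔ IsLinear σ := by
  rw [isLinear_iff]
  refine ⟨fun h => Submodule.map_le_iff_le_comap.1 h.le, fun h =>
    Submodule.eq_of_le_of_finrank_eq (Submodule.map_le_iff_le_comap.2 h) ?_⟩
  exact (Submodule.equivMapOfInjective _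
    (LinearMap.funLeft_injective_of_surjective _ _ _ σ.surjective) theCode).finrank_eq.symm

theorem card_isAut : Nat.card {σ : Equiv.Perm (Fin 24) // IsAut σ} = 240 := by
  let f : {σ : Equiv.Perm (Fin 24) // IsAut σ} → (extensions 7 []).toFinset := fun σ =>
    ⟨images σ.1, List.mem_toFinset.2 <| mem_extensions (images_subset _)
      (fun _ hx => tableWeight_combine_images ((isAut_iff _).1 σ.2) ((isAut_iff _).1 σ.2.symm) hx)
      (List.nil_suffix) rfl⟩
  have hf : Function.Bijective f := by
    constructor
    · intro σ τ h
      refine Subtype.ext (Equiv.ext fun i => column_injective ?_)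
      have h : images σ.1 = images τ.1 := congrArg Subtype.val h
      rw [(isAut_iff _).1 σ.2 i, (isAut_iff _).1 τ.2 i, h]
    · rintro ⟨T, hT⟩
      obtain ⟨σ, hσ, rfl⟩ := exists_perm_of_mem_extensions (List.mem_toFinset.1 hT)
      exact ⟨⟨σ, (isAut_iff σ).2 hσ⟩, rfl⟩
  rw [Nat.card_eq_of_bijective f hf, Nat.card_eq_fintype_card, Fintype.card_coe,
    List.toFinset_card_of_nodup (nodup_extensions 7 []), length_extensions]

/-- The given code is a [24,7,10] code and its automorphism group
has order 240. -/
theorem code_props :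
    Module.finrank (ZMod 2) theCode = 7 ∧
    (∀ v ∈ theCode, v ≠ 0 → 10 ≤ hammingNorm v) ∧
    Nat.card {σ : Equiv.Perm (Fin 24) //
        Submodule.map (LinearMap.funLeft (ZMod 2) (ZMod 2) σ) theCode = theCode} = 240 :=
  ⟨finrank_theCode, fun _ hv h0 => ten_le_hammingNorm hv h0, card_isAut⟩
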